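/- arXiv:1810.12671 — 3 statements merged into one kernel-verified Lean document; each statement's English description precedes it below -/
import Mathlib

section
/- Let s ∈ ℕ and let (x_n)_{n≥0} be the s-dimensional generalized Halton sequence in rational bases (u_1/v_1,…,u_s/v_s). Then limsup_{N→∞} N·D*_N((x_n))/(log N)^s > 0, i.e., there is a constant c > 0 such that N·D*_N ≥ c·(log N)^s for infinitely many N. -/
open Finset

/-- The auxiliary integers `z_r` in the formal `u/v`-adic expansion of an integer `z`:
`z_0 = z` and `z_{r+1} = (v·z_r − a_{r+1})/u`, where `a_{r+1} = (v·z_r) mod u` is the unique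
element of `{0,…,u−1}` with `u ∣ (v·z_r − a_{r+1})`. -/
def ratZ (u v : ℕ) (z : ℤ) : ℕ → ℤ
  | 0 => z
  | r + 1 => ((v : ℤ) * ratZ u v z r - ((v : ℤ) * ratZ u v z r) % (u : ℤ)) / (u : ℤ)

/-- `ratDigit u v z r` is the digit `a_{r+1}` of the formal `u/v`-adic expansion of `z`,
i.e. the unique element of `{0,…,u−1}` with `u ∣ (v·z_r − a_{r+1})`. -/
def ratDigit (u v : ℕ) (z : ℤ) (r : ℕ) : ℕ :=
  (((v : ℤ) * ratZ u v z r) % (u : ℤ)).toNat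

/-- The generalized `u/v`-adic radical inverse function
`φ^Σ_{u/v}(n) = Σ_{r≥1} σ_r(a_r)/u^r`, where `σ r` is the permutation `σ_{r+1}` of
`{0,…,u−1}` and `a_{r+1} = ratDigit u v n r`. -/
noncomputable def ratPhi (u v : ℕ) (σ : ℕ → ℕ → ℕ) (n : ℕ) : ℝ :=
  ∑' r : ℕ, (σ r (ratDigit u v (n : ℤ) r) : ℝ) / (u : ℝ) ^ (r + 1)

/-- The truncation `[φ^Σ_{u/v}(n)]_t = Σ_{r=1}^t σ_r(a_r)/u^r` of the generalized
`u/v`-adic radical inverse function to its first `t` prescribed digits. -/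
noncomputable def ratPhiTrunc (u v : ℕ) (σ : ℕ → ℕ → ℕ) (t n : ℕ) : ℝ :=
  ∑ r ∈ Finset.range t, (σ r (ratDigit u v (n : ℤ) r) : ℝ) / (u : ℝ) ^ (r + 1)

/-- The star discrepancy `D*_N` of the first `N` points of the sequence `x` in `[0,1]^s`:
`D*_N = sup_{y ∈ (0,1]^s} |#{0 ≤ n < N : x_n^{(i)} < y^{(i)}, i=1,…,s}/N − Π_i y^{(i)}|`. -/
noncomputable def starDisc (s N : ℕ) (x : ℕ → Fin s → ℝ) : ℝ :=
  sSup { d : ℝ | ∃ y : Fin s → ℝ, (∀ i, y i ∈ Set.Ioc (0 : ℝ) 1) ∧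
    d = |(Nat.card {n : ℕ | n < N ∧ ∀ i, x n i < y i} : ℝ) / N - ∏ i, y i| }

section Digits

lemma ratDigit_lt {u : ℕ} (hu : 0 < u) (v : ℕ) (z : ℤ) (r : ℕ) : ratDigit u v z r < u := by
  have h := Int.emod_lt_of_pos ((v : ℤ) * ratZ u v z r) (Int.natCast_pos.2 hu)
  have h' := Int.emod_nonneg ((v : ℤ) * ratZ u v z r) (Int.natCast_pos.2 hu).ne'
  unfold ratDigit
  omega

lemma mul_ratZ {u : ℕ} (hu : 0 < u) (v : ℕ) (z : ℤ) (r : ℕ) :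
    (v : ℤ) * ratZ u v z r = ratDigit u v z r + u * ratZ u v z (r + 1) := by
  have hu' : (u : ℤ) ≠ 0 := by exact_mod_cast hu.ne'
  have h' := Int.emod_nonneg ((v : ℤ) * ratZ u v z r) hu'
  have h := Int.mul_ediv_add_emod ((v : ℤ) * ratZ u v z r) u
  unfold ratDigit
  rw [Int.toNat_of_nonneg h', ratZ,
    show (v : ℤ) * ratZ u v z r - (v * ratZ u v z r) % u
      = u * ((v * ratZ u v z r) / u) by linarith,
    Int.mul_ediv_cancel_left _ hu']
  linarith

lemma natCast_isCoprime_pow {u v : ℕ} (h : Nat.Coprime u v) (a b : ℕ) :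
    IsCoprime ((u : ℤ) ^ a) ((v : ℤ) ^ b) :=
  (Nat.isCoprime_iff_coprime.2 h).pow

/-- Integers congruent modulo `u ^ r` keep their difference, up to scaling, along the expansion. -/
lemma pow_mul_sub_of_dvd {u v : ℕ} (hu : 0 < u) {z w : ℤ} {r : ℕ}
    (h : (u : ℤ) ^ r ∣ z - w) :
    (v : ℤ) ^ r * (z - w) = u ^ r * (ratZ u v z r - ratZ u v w r) := by
  induction r with
  | zero => simp [ratZ]
  | succ r ih =>
    have hu' : (u : ℤ) ≠ 0 := by exact_mod_cast hu.ne'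
    have hr := ih ((pow_dvd_pow _ r.le_succ).trans h)
    have hz := mul_ratZ hu v z r
    have hw := mul_ratZ hu v w r
    have hdvd : (u : ℤ) ∣ ratZ u v z r - ratZ u v w r := by
      refine Int.dvd_of_mul_dvd_mul_left (pow_ne_zero r hu') ?_
      rw [← pow_succ, ← hr]
      exact h.mul_left _
    have hdig : (ratDigit u v z r : ℤ) = ratDigit u v w r := by
      have h1 := ratDigit_lt hu v z r
      have h2 := ratDigit_lt hu v w r
      have h3 : (u : ℤ) ∣ ratDigit u v z r - ratDigit u v w r := by
        have : (ratDigit u v z r : ℤ) - ratDigit u v w r = v * (ratZ u v z r - ratZ u v w r)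
            - u * (ratZ u v z (r + 1) - ratZ u v w (r + 1)) := by linarith
        rw [this]
        exact dvd_sub (hdvd.mul_left _) (dvd_mul_right _ _)
      have h4 := Int.eq_zero_of_abs_lt_dvd h3 (by rw [abs_lt]; constructor <;> omega)
      linarith
    calc (v : ℤ) ^ (r + 1) * (z - w) = v * (v ^ r * (z - w)) := by ring
      _ = u ^ r * (v * ratZ u v z r - v * ratZ u v w r) := by rw [hr]; ring
      _ = _ := by rw [hz, hw, hdig]; ring

lemma pow_succ_dvd_sub_digit {u v : ℕ} (hu : 0 < u) {z w : ℤ} {r : ℕ}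
    (h : (u : ℤ) ^ r ∣ z - w) :
    (u : ℤ) ^ (r + 1) ∣
      v ^ (r + 1) * (z - w) - u ^ r * (ratDigit u v z r - ratDigit u v w r) := by
  have h1 := pow_mul_sub_of_dvd hu (v := v) h
  have hz := mul_ratZ hu v z r
  have hw := mul_ratZ hu v w r
  refine ⟨ratZ u v z (r + 1) - ratZ u v w (r + 1), ?_⟩
  linear_combination (v : ℤ) * h1 + (u : ℤ) ^ r * hz - (u : ℤ) ^ r * hw

lemma ratDigit_eq_iff {u v : ℕ} (hu : 0 < u) (huv : Nat.Coprime u v) {z w : ℤ} {r : ℕ}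
    (h : (u : ℤ) ^ r ∣ z - w) :
    ratDigit u v z r = ratDigit u v w r ↔ (u : ℤ) ^ (r + 1) ∣ z - w := by
  have key := pow_succ_dvd_sub_digit hu (v := v) h
  have hu' : (u : ℤ) ≠ 0 := by exact_mod_cast hu.ne'
  constructor
  · intro he
    rw [he, sub_self, mul_zero, sub_zero] at key
    exact (natCast_isCoprime_pow huv _ _).dvd_of_dvd_mul_left key
  · intro hd
    have h3 : (u : ℤ) ∣ ratDigit u v z r - ratDigit u v w r := by
      refine Int.dvd_of_mul_dvd_mul_left (pow_ne_zero r hu') ?_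
      rw [← pow_succ]
      exact (dvd_sub_right (hd.mul_left _)).1 key
    have h1 := ratDigit_lt hu v z r
    have h2 := ratDigit_lt hu v w r
    have h4 := Int.eq_zero_of_abs_lt_dvd h3 (by rw [abs_lt]; constructor <;> omega)
    omega

/-- The integer `u ^ t * ratPhiTrunc u v σ t n`. -/
def revInt (u v : ℕ) (σ : ℕ → ℕ → ℕ) (n : ℕ) : ℕ → ℕ
  | 0 => 0
  | t + 1 => u * revInt u v σ n t + σ t (ratDigit u v n t)

lemma mul_add_eq_iff {u a b x y : ℕ} (hx : x < u) (hy : y < u) :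
    u * a + x = u * b + y ↔ a = b ∧ x = y := by
  constructor
  · intro h
    have hu : 0 < u := by omega
    have h1 : a = b := by
      have := congrArg (· / u) h
      simpa [Nat.mul_add_div hu, Nat.div_eq_of_lt hx, Nat.div_eq_of_lt hy] using this
    subst h1
    exact ⟨rfl, by omega⟩
  · rintro ⟨rfl, rfl⟩
    rfl

lemma mul_add_lt_iff {u a b x y : ℕ} (hx : x < u) (hy : y < u) :
    u * a + x < u * b + y ↔ a < b ∨ a = b ∧ x < y := by
  rcases lt_trichotomy a b with h | h | h
  · have : u * (a + 1) ≤ u * b := Nat.mul_le_mul_left u h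
    simp only [h, true_or, iff_true]
    linarith
  · subst h
    simp
  · have : u * (b + 1) ≤ u * a := Nat.mul_le_mul_left u h
    simp only [h.not_gt, h.ne', false_and, or_false, iff_false, not_lt]
    linarith

variable {u v : ℕ} {σ : ℕ → ℕ → ℕ} (hu : 0 < u)
  (hσ : ∀ r, Set.BijOn (σ r) (Set.Iio u) (Set.Iio u))

include hu hσ

lemma perm_ratDigit_lt (z : ℤ) (r : ℕ) : σ r (ratDigit u v z r) < u :=
  (hσ r).mapsTo (ratDigit_lt hu v z r)

lemma revInt_lt (n t : ℕ) : revInt u v σ n t < u ^ t := by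
  induction t with
  | zero => simp [revInt]
  | succ t ih =>
    have h1 := perm_ratDigit_lt hu hσ (v := v) n t
    have h2 : u * (revInt u v σ n t + 1) ≤ u * u ^ t := Nat.mul_le_mul_left u ih
    rw [revInt, pow_succ']
    linarith

lemma revInt_eq_iff (huv : Nat.Coprime u v) (n m t : ℕ) :
    revInt u v σ n t = revInt u v σ m t ↔ (u : ℤ) ^ t ∣ (n : ℤ) - m := by
  induction t with
  | zero => simp [revInt]
  | succ t ih =>
    rw [revInt, revInt, mul_add_eq_iff (perm_ratDigit_lt hu hσ _ _) (perm_ratDigit_lt hu hσ _ _),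
      (hσ t).injOn.eq_iff (ratDigit_lt hu v _ _) (ratDigit_lt hu v _ _), ih]
    constructor
    · rintro ⟨h1, h2⟩
      exact (ratDigit_eq_iff hu huv h1).1 h2
    · intro h
      have h1 := (pow_dvd_pow (u : ℤ) t.le_succ).trans h
      exact ⟨h1, (ratDigit_eq_iff hu huv h1).2 h⟩

lemma revInt_add_one_mul_le (n : ℕ) {t T : ℕ} (h : t ≤ T) :
    revInt u v σ n T + 1 ≤ (revInt u v σ n t + 1) * u ^ (T - t) := by
  induction T, h using Nat.le_induction with
  | base => simp
  | succ T h ih =>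
    have h1 := perm_ratDigit_lt hu hσ (v := v) n T
    rw [revInt, Nat.succ_sub h, pow_succ]
    nlinarith [Nat.mul_le_mul_left u ih]

omit hσ in
lemma ratPhiTrunc_eq (n t : ℕ) : ratPhiTrunc u v σ t n = (revInt u v σ n t : ℝ) / u ^ t := by
  have hu' : (u : ℝ) ≠ 0 := by exact_mod_cast hu.ne'
  induction t with
  | zero => simp [ratPhiTrunc, revInt]
  | succ t ih =>
    have : ratPhiTrunc u v σ (t + 1) n
        = ratPhiTrunc u v σ t n + (σ t (ratDigit u v (n : ℤ) t) : ℝ) / (u : ℝ) ^ (t + 1) :=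
      Finset.sum_range_succ _ _
    rw [this, ih, revInt]
    push_cast
    field_simp
    ring

lemma ratPhiTrunc_le (n t T : ℕ) :
    ratPhiTrunc u v σ T n ≤ (revInt u v σ n t + 1 : ℝ) / u ^ t := by
  have hu' : (0 : ℝ) < u := by exact_mod_cast hu
  have key : ∀ T', t ≤ T' → ratPhiTrunc u v σ T' n ≤ (revInt u v σ n t + 1 : ℝ) / u ^ t := by
    intro T' h
    have h1 := revInt_add_one_mul_le hu hσ (v := v) n h
    have h2 : (revInt u v σ n T' + 1 : ℝ) ≤ (revInt u v σ n t + 1) * u ^ (T' - t) := by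
      exact_mod_cast h1
    rw [ratPhiTrunc_eq hu, div_le_div_iff₀ (by positivity) (by positivity)]
    have h3 : (u : ℝ) ^ T' = u ^ (T' - t) * u ^ t := by rw [← pow_add, Nat.sub_add_cancel h]
    rw [h3, ← mul_assoc]
    gcongr
    linarith
  refine le_trans ?_ (key (max t T) (le_max_left _ _))
  exact Finset.sum_le_sum_of_subset_of_nonneg (Finset.range_mono (le_max_right _ _))
    fun _ _ _ => by positivity

lemma le_ratPhi (n t : ℕ) : (revInt u v σ n t : ℝ) / u ^ t ≤ ratPhi u v σ n := by
  rw [← ratPhiTrunc_eq hu]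
  exact (summable_of_sum_range_le (fun _ => by positivity)
    fun T => ratPhiTrunc_le hu hσ n 0 T).sum_le_tsum _ fun _ _ => by positivity

lemma ratPhi_le (n t : ℕ) : ratPhi u v σ n ≤ (revInt u v σ n t + 1 : ℝ) / u ^ t :=
  Real.tsum_le_of_sum_range_le (fun _ => by positivity) fun T => ratPhiTrunc_le hu hσ n t T

/-- At most one integer lies in `[0, Y / u ^ t)` by its first `t` digits and yet is mapped to the
right endpoint. -/
lemma eq_of_ratPhi_ge (hu2 : 2 ≤ u) (huv : Nat.Coprime u v) {n m t Y : ℕ}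
    (hn : revInt u v σ n t < Y) (hn' : (Y : ℝ) / u ^ t ≤ ratPhi u v σ n)
    (hm : revInt u v σ m t < Y) (hm' : (Y : ℝ) / u ^ t ≤ ratPhi u v σ m) : n = m := by
  have hu' : (0 : ℝ) < u := by exact_mod_cast hu
  have key : ∀ k : ℕ, revInt u v σ k t < Y → (Y : ℝ) / u ^ t ≤ ratPhi u v σ k →
      ∀ T, t ≤ T → revInt u v σ k T + 1 = Y * u ^ (T - t) := by
    intro k hk hk' T hT
    refine le_antisymm ?_ ?_
    · exact (revInt_add_one_mul_le hu hσ k hT).trans (Nat.mul_le_mul_right _ hk)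
    · have h := hk'.trans (ratPhi_le hu hσ k T)
      rw [div_le_div_iff₀ (by positivity) (by positivity)] at h
      have h3 : (u : ℝ) ^ T = u ^ (T - t) * u ^ t := by rw [← pow_add, Nat.sub_add_cancel hT]
      rw [h3, ← mul_assoc] at h
      exact_mod_cast le_of_mul_le_mul_right h (by positivity)
  obtain ⟨T, hT⟩ : ∃ T, n + m < u ^ T := ⟨n + m, Nat.lt_pow_self hu2⟩
  have hT' : n + m < u ^ (max t T) := hT.trans_le (Nat.pow_le_pow_right hu (le_max_right _ _))
  have h1 := key n hn hn' _ (le_max_left t T)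
  have h2 := key m hm hm' _ (le_max_left t T)
  have h3 := (revInt_eq_iff hu hσ huv n m (max t T)).1 (by omega)
  have h4 := Int.eq_zero_of_abs_lt_dvd h3 (by
    have : ((n + m : ℕ) : ℤ) < ((u ^ max t T : ℕ) : ℤ) := by exact_mod_cast hT'
    push_cast at this
    rw [abs_lt]
    constructor <;> linarith)
  omega

end Digits

section Corner

/-- The integer `∑ r ∈ S with r < t, u ^ (t - 1 - r)`, whose base-`u` digits are the indicator
of `S`. -/
def cornerInt (u : ℕ) (S : Finset ℕ) : ℕ → ℕ
  | 0 => 0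
  | t + 1 => u * cornerInt u S t + if t ∈ S then 1 else 0

lemma cornerInt_lt {u : ℕ} (hu : 2 ≤ u) (S : Finset ℕ) (t : ℕ) : cornerInt u S t < u ^ t := by
  induction t with
  | zero => simp [cornerInt]
  | succ t ih =>
    have h2 : u * (cornerInt u S t + 1) ≤ u * u ^ t := Nat.mul_le_mul_left u ih
    rw [cornerInt, pow_succ']
    split_ifs <;> linarith

lemma cornerInt_div {u : ℕ} (hu : 0 < u) {S : Finset ℕ} {T : ℕ} (hS : S ⊆ Finset.range T) :
    (cornerInt u S T : ℝ) / u ^ T = ∑ r ∈ S, 1 / (u : ℝ) ^ (r + 1) := by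
  have hu' : (u : ℝ) ≠ 0 := by exact_mod_cast hu.ne'
  have key : ∀ t, (cornerInt u S t : ℝ) / u ^ t
      = ∑ r ∈ Finset.range t, if r ∈ S then 1 / (u : ℝ) ^ (r + 1) else 0 := by
    intro t
    induction t with
    | zero => simp [cornerInt]
    | succ t ih =>
      rw [Finset.sum_range_succ, ← ih, cornerInt]
      split_ifs <;> push_cast <;> field_simp <;> ring
  rw [key, ← Finset.sum_filter, Finset.filter_mem_eq_inter, Finset.inter_eq_right.2 hS]

variable {u v : ℕ} {σ : ℕ → ℕ → ℕ} (hu : 2 ≤ u)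
  (hσ : ∀ r, Set.BijOn (σ r) (Set.Iio u) (Set.Iio u))

include hu hσ

/-- The half-open interval with right endpoint given by `S` splits into one elementary interval
for each element of `S`. -/
lemma indicator_revInt_lt {S : Finset ℕ} {T : ℕ} (hS : S ⊆ Finset.range T) (n : ℕ) :
    (if revInt u v σ n T < cornerInt u S T then (1 : ℝ) else 0)
      = ∑ r ∈ S, if revInt u v σ n (r + 1) = u * cornerInt u S r then (1 : ℝ) else 0 := by
  have hu0 : 0 < u := by omega
  have key : ∀ t, (if revInt u v σ n t < cornerInt u S t then (1 : ℝ) else 0)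
      = ∑ r ∈ Finset.range t, if r ∈ S then
        (if revInt u v σ n (r + 1) = u * cornerInt u S r then (1 : ℝ) else 0) else 0 := by
    intro t
    induction t with
    | zero => simp [cornerInt]
    | succ t ih =>
      have h1 := perm_ratDigit_lt hu0 hσ (v := v) n t
      have h2 : (if t ∈ S then 1 else 0) < u := by split_ifs <;> omega
      have h3 : revInt u v σ n (t + 1) = u * cornerInt u S t ↔
          revInt u v σ n t = cornerInt u S t ∧ σ t (ratDigit u v n t) = 0 := by
        rw [revInt, ← mul_add_eq_iff h1 hu0, add_zero]
      rw [Finset.sum_range_succ, ← ih]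
      simp only [h3]
      simp only [revInt, cornerInt, mul_add_lt_iff h1 h2]
      by_cases ht : t ∈ S
      · simp only [ht, if_true, Nat.lt_one_iff]
        by_cases h4 : revInt u v σ n t < cornerInt u S t
        · simp [h4, h4.ne]
        · simp [h4]
      · simp [ht]
  rw [key, ← Finset.sum_filter, Finset.filter_mem_eq_inter, Finset.inter_eq_right.2 hS]

lemma revInt_eq_cornerInt_of_le {S : Finset ℕ} {T W : ℕ}
    (hW : revInt u v σ W T = cornerInt u S T) {t : ℕ} (ht : t ≤ T) :
    revInt u v σ W t = cornerInt u S t := by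
  induction T, ht using Nat.le_induction with
  | base => exact hW
  | succ T ht ih =>
    refine ih ((mul_add_eq_iff (u := u) (perm_ratDigit_lt (by omega) hσ W T) ?_).1 hW).1
    split_ifs <;> omega

/-- The difference modulo `u` of the digits that `σ r` maps to `0` and `1`. -/
lemma exists_digit_jump (r : ℕ) : ∃ D, 0 < D ∧ D < u ∧ ∃ a b, a < u ∧ b < u ∧
    σ r a = 0 ∧ σ r b = 1 ∧ (u : ℤ) ∣ (a : ℤ) - b - D := by
  obtain ⟨a, ha, ha'⟩ := (hσ r).surjOn (show 0 ∈ Set.Iio u by simp; omega)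
  obtain ⟨b, hb, hb'⟩ := (hσ r).surjOn (show 1 ∈ Set.Iio u by simp; omega)
  have hab : a ≠ b := by rintro rfl; omega
  rw [Set.mem_Iio] at ha hb
  rcases lt_or_gt_of_ne hab with h | h
  · exact ⟨a + u - b, by omega, by omega, a, b, ha, hb, ha', hb', -1, by
      rw [Nat.cast_sub (by omega)]; push_cast; ring⟩
  · exact ⟨a - b, by omega, by omega, a, b, ha, hb, ha', hb', 0, by
      rw [Nat.cast_sub (by omega)]; ring⟩

lemma revInt_add_eq_iff (huv : Nat.Coprime u v) {S : Finset ℕ} {T W r D a b : ℕ}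
    (hW : revInt u v σ W T = cornerInt u S T) (hrT : r < T) (hrS : r ∈ S)
    (hv : (v : ℤ) ^ (r + 1) ≡ 1 [ZMOD u]) (ha : a < u) (hb : b < u)
    (ha0 : σ r a = 0) (hb1 : σ r b = 1) (hD : (u : ℤ) ∣ (a : ℤ) - b - D) (j : ℕ) :
    revInt u v σ (W + j) (r + 1) = u * cornerInt u S r ↔
      (u : ℤ) ^ (r + 1) ∣ (j : ℤ) - D * u ^ r := by
  have hu0 : 0 < u := by omega
  have hu' : (u : ℤ) ≠ 0 := by exact_mod_cast hu0.ne'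
  have hWr := revInt_eq_cornerInt_of_le hu hσ hW hrT.le
  have hWd : ratDigit u v W r = b := by
    have h := revInt_eq_cornerInt_of_le hu hσ hW (Nat.succ_le_of_lt hrT)
    rw [Nat.succ_eq_add_one, revInt, cornerInt, if_pos hrS,
      mul_add_eq_iff (perm_ratDigit_lt hu0 hσ _ _) (by omega), ← hb1] at h
    exact (hσ r).injOn (ratDigit_lt hu0 _ _ _) hb h.2
  have hj : (u : ℤ) ^ r ∣ j →
      (u : ℤ) ^ (r + 1) ∣ j - u ^ r * (ratDigit u v (W + j : ℕ) r - b) := by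
    intro h
    have h1 : (u : ℤ) ^ r ∣ ((W + j : ℕ) : ℤ) - W := by simpa using h
    have h2 := pow_succ_dvd_sub_digit hu0 (v := v) h1
    obtain ⟨c, hc⟩ := h
    have h3 : (u : ℤ) ^ (r + 1) ∣ ((v : ℤ) ^ (r + 1) - 1) * j := by
      rw [hc, pow_succ', ← mul_assoc]
      exact (mul_dvd_mul hv.symm.dvd (dvd_refl _)).mul_right _
    rw [hWd] at h2
    have h4 := dvd_sub h2 h3
    have h5 : ((W + j : ℕ) : ℤ) - W = j := by push_cast; ring
    rw [h5] at h4
    exact h4.trans (dvd_of_eq (by ring))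
  have hstep : revInt u v σ (W + j) (r + 1) = u * cornerInt u S r ↔
      (u : ℤ) ^ r ∣ j ∧ ratDigit u v (W + j : ℕ) r = a := by
    rw [← add_zero (u * cornerInt u S r), revInt,
      mul_add_eq_iff (perm_ratDigit_lt hu0 hσ _ _) hu0, ← hWr, revInt_eq_iff hu0 hσ huv,
      ← ha0, (hσ r).injOn.eq_iff (ratDigit_lt hu0 v _ _) ha]
    simp
  rw [hstep]
  have hDr : (u : ℤ) ^ (r + 1) ∣ u ^ r * ((a : ℤ) - b) - D * u ^ r := by
    rw [mul_comm (D : ℤ), ← mul_sub, pow_succ]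
    exact mul_dvd_mul_left _ hD
  constructor
  · rintro ⟨h1, h2⟩
    have h3 := dvd_add (hj h1) hDr
    rw [h2] at h3
    simpa using h3
  · intro h
    have h1 : (u : ℤ) ^ r ∣ j :=
      (dvd_sub_left (dvd_mul_left _ _)).1 ((pow_dvd_pow (u : ℤ) r.le_succ).trans h)
    refine ⟨h1, ?_⟩
    have h2 := dvd_sub (dvd_sub h (hj h1)) hDr
    have h3 : (u : ℤ) ∣ ratDigit u v (W + j : ℕ) r - a := by
      refine Int.dvd_of_mul_dvd_mul_left (pow_ne_zero r hu') ?_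
      rw [← pow_succ]
      exact h2.trans (dvd_of_eq (by ring))
    have h4 := ratDigit_lt hu0 v (W + j : ℕ) r
    have h5 := Int.eq_zero_of_abs_lt_dvd h3 (by rw [abs_lt]; constructor <;> omega)
    omega

end Corner

section Residue

lemma card_filter_mod_sub {M x : ℕ} (hx : x < M) (N : ℕ) :
    (#{j ∈ Finset.range N | j % M = x} : ℝ) - N / M
      = (if x < N % M then 1 else 0) - ((N % M : ℕ) : ℝ) / M := by
  have hM : 0 < M := by omega
  have hM' : (M : ℝ) ≠ 0 := by exact_mod_cast hM.ne'
  have h1 := Nat.count_modEq_card N hM x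
  rw [Nat.count_eq_card_filter_range, Nat.mod_eq_of_lt hx] at h1
  have h2 : {j ∈ Finset.range N | j % M = x} = {j ∈ Finset.range N | j ≡ x [MOD M]} := by
    simp only [Nat.ModEq, Nat.mod_eq_of_lt hx]
  have h3 : (N : ℝ) = M * (N / M : ℕ) + (N % M : ℕ) := by exact_mod_cast (Nat.div_add_mod N M).symm
  have h4 : (N : ℝ) / M = (N / M : ℕ) + ((N % M : ℕ) : ℝ) / M := by
    rw [div_eq_iff hM', add_mul, div_mul_cancel₀ _ hM', mul_comm]
    exact h3
  rw [h2, h1, h4]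
  push_cast
  ring

lemma sum_card_filter_mod_sub {M x : ℕ} (hx : x < M) (K : ℕ) :
    ∑ N ∈ Finset.range (M * K), ((#{j ∈ Finset.range N | j % M = x} : ℝ) - N / M)
      = K * (((M : ℝ) - 1) / 2 - x) := by
  have hM' : (M : ℝ) ≠ 0 := by exact_mod_cast (show M ≠ 0 by omega)
  simp only [card_filter_mod_sub hx]
  induction K with
  | zero => simp
  | succ K ih =>
    rw [mul_add, mul_one, Finset.sum_range_add, ih]
    have h1 : ∀ N ∈ Finset.range M, ((if x < (M * K + N) % M then (1 : ℝ) else 0)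
        - (((M * K + N) % M : ℕ) : ℝ) / M) = (if x < N then 1 else 0) - (N : ℝ) / M := by
      intro N hN
      rw [Nat.mul_add_mod, Nat.mod_eq_of_lt (Finset.mem_range.1 hN)]
    rw [Finset.sum_congr rfl h1, Finset.sum_sub_distrib, ← Finset.sum_div,
      ← Finset.natCast_card_filter]
    have h2 : #{N ∈ Finset.range M | x < N} = M - 1 - x := by
      rw [show {N ∈ Finset.range M | x < N} = Finset.Ioo x M by ext; simp; tauto, Nat.card_Ioo]
      omega
    have h3 : (∑ N ∈ Finset.range M, (N : ℝ)) * 2 = M * (M - 1) := by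
      have := Finset.sum_range_id_mul_two M
      have h4 : ((M - 1 : ℕ) : ℝ) = M - 1 := by rw [Nat.cast_sub (by omega)]; simp
      rw [← h4, ← Nat.cast_mul, ← this]
      push_cast
      rfl
    have h4 : ((M - 1 - x : ℕ) : ℝ) = M - 1 - x := by
      rw [Nat.cast_sub (by omega), Nat.cast_sub (by omega)]; simp
    rw [h2, h4, eq_div_of_mul_eq two_ne_zero h3]
    push_cast
    field_simp
    ring

variable {s : ℕ} {u : Fin s → ℕ}

lemma exists_common_numerator (hu : ∀ i, 0 < u i) (D : Fin s → ℕ) :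
    ∃ κ < ∏ i, u i, ∀ i, (u i : ℤ) ∣ κ - D i * ∏ j ∈ univ.erase i, (u j : ℤ) := by
  refine ⟨(∑ j, D j * ∏ l ∈ univ.erase j, u l) % ∏ i, u i,
    Nat.mod_lt _ (Finset.prod_pos fun i _ => hu i), fun i => ?_⟩
  have h1 : (u i : ℤ) ∣ (((∑ j, D j * ∏ l ∈ univ.erase j, u l) % ∏ i, u i : ℕ) : ℤ)
      - (∑ j, D j * ∏ l ∈ univ.erase j, u l : ℕ) := by
    refine dvd_trans (?_ : (u i : ℤ) ∣ ((∏ i, u i : ℕ) : ℤ)) ?_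
    · exact_mod_cast Finset.dvd_prod_of_mem u (Finset.mem_univ i)
    · push_cast
      exact (Int.mod_modEq _ _).symm.dvd
  have h2 : (u i : ℤ) ∣ ((∑ j, D j * ∏ l ∈ univ.erase j, u l : ℕ) : ℤ)
      - D i * ∏ j ∈ univ.erase i, (u j : ℤ) := by
    rw [← Finset.add_sum_erase _ _ (Finset.mem_univ i)]
    push_cast
    rw [add_sub_cancel_left]
    refine Finset.dvd_sum fun j hj => ?_
    refine (Finset.dvd_prod_of_mem (fun l => (u l : ℤ)) ?_).mul_left _
    exact Finset.mem_erase.2 ⟨(Finset.mem_erase.1 hj).1.symm, Finset.mem_univ i⟩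
  simpa using dvd_add h1 h2

lemma mod_prod_eq_iff (hcop : ∀ i j, i ≠ j → Nat.Coprime (u i) (u j)) {D : Fin s → ℕ} {κ : ℕ}
    (hκ : κ < ∏ i, u i)
    (hκD : ∀ i, (u i : ℤ) ∣ κ - D i * ∏ j ∈ univ.erase i, (u j : ℤ)) {r : Fin s → ℕ}
    (hr : ∀ i j, i ≠ j → (u j : ℤ) ^ (r j + 1) ≡ 1 [ZMOD u i]) (j : ℕ) :
    (∀ i, (u i : ℤ) ^ (r i + 1) ∣ (j : ℤ) - D i * u i ^ r i) ↔
      j % ∏ i, u i ^ (r i + 1) = κ * ∏ i, u i ^ r i := by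
  have hpos : 0 < ∏ i, u i := by omega
  have hu : ∀ i, 0 < u i := fun i =>
    Nat.pos_of_ne_zero fun h => hpos.ne' (Finset.prod_eq_zero (Finset.mem_univ i) h)
  have hx : ∀ i, (u i : ℤ) ^ (r i + 1) ∣
      ((κ * ∏ i, u i ^ r i : ℕ) : ℤ) - D i * u i ^ r i := by
    intro i
    have h1 : (∏ l ∈ univ.erase i, (u l : ℤ) ^ (r l + 1)) ≡ 1 [ZMOD u i] := by
      refine Int.ModEq.prod_one fun l hl => ?_
      exact hr i l (Finset.mem_erase.1 hl).1.symm
    have h2 : (u i : ℤ) ∣ κ * ∏ l ∈ univ.erase i, (u l : ℤ) ^ r l - D i := by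
      have h3 := dvd_add ((hκD i).mul_right (∏ l ∈ univ.erase i, (u l : ℤ) ^ r l))
        (h1.symm.dvd.mul_left (D i))
      refine h3.trans (dvd_of_eq ?_)
      simp only [pow_succ, Finset.prod_mul_distrib]
      ring
    rw [← Finset.mul_prod_erase _ _ (Finset.mem_univ i)]
    push_cast
    rw [pow_succ]
    exact (mul_dvd_mul_left ((u i : ℤ) ^ r i) h2).trans (dvd_of_eq (by ring))
  have hlt : κ * ∏ i, u i ^ r i < ∏ i, u i ^ (r i + 1) := by
    simp only [pow_succ, Finset.prod_mul_distrib]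
    rw [mul_comm]
    exact Nat.mul_lt_mul_of_pos_left hκ (Finset.prod_pos fun i _ => pow_pos (hu i) _)
  have hdvd : (∀ i, (u i : ℤ) ^ (r i + 1) ∣ (j : ℤ) - D i * u i ^ r i) ↔
      ∏ i, (u i : ℤ) ^ (r i + 1) ∣ (j : ℤ) - (κ * ∏ i, u i ^ r i : ℕ) := by
    have h1 : (∀ i, (u i : ℤ) ^ (r i + 1) ∣ (j : ℤ) - D i * u i ^ r i) ↔
        ∀ i, (u i : ℤ) ^ (r i + 1) ∣ (j : ℤ) - (κ * ∏ i, u i ^ r i : ℕ) := by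
      refine forall_congr' fun i => ?_
      rw [← dvd_sub_left (hx i)]
      simp
    rw [h1]
    constructor
    · exact Fintype.prod_dvd_of_coprime fun i l hil =>
        natCast_isCoprime_pow (hcop i l hil) _ _
    · exact fun h i => (Finset.dvd_prod_of_mem (fun i => (u i : ℤ) ^ (r i + 1))
        (Finset.mem_univ i)).trans h
  rw [hdvd]
  have h2 : j % ∏ i, u i ^ (r i + 1) = κ * ∏ i, u i ^ r i ↔
      κ * ∏ i, u i ^ r i ≡ j [MOD ∏ i, u i ^ (r i + 1)] := by
    rw [Nat.ModEq, Nat.mod_eq_of_lt hlt, eq_comm]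
  rw [h2, Nat.modEq_iff_dvd]
  push_cast
  rfl

/-- If the common residue were half the modulus, two bases would be even. -/
lemma two_mul_ne_prod (hcop : ∀ i j, i ≠ j → Nat.Coprime (u i) (u j)) (hs : 2 ≤ s)
    {D : Fin s → ℕ} (hD : ∀ i, 0 < D i) (hDu : ∀ i, D i < u i) {κ : ℕ}
    (hκD : ∀ i, (u i : ℤ) ∣ κ - D i * ∏ j ∈ univ.erase i, (u j : ℤ)) :
    2 * κ ≠ ∏ i, u i := by
  intro h
  have heven : ∀ i, 2 ∣ u i := by
    intro i
    have h1 : (u i : ℤ) ∣ 2 * κ := by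
      rw [show (2 * κ : ℤ) = ((∏ i, u i : ℕ) : ℤ) by exact_mod_cast h]
      exact_mod_cast Finset.dvd_prod_of_mem u (Finset.mem_univ i)
    have h2 : (u i : ℤ) ∣ 2 * D i * ∏ j ∈ univ.erase i, (u j : ℤ) :=
      (dvd_sub h1 ((hκD i).mul_left 2)).trans (dvd_of_eq (by ring))
    have h3 : IsCoprime (u i : ℤ) (∏ j ∈ univ.erase i, (u j : ℤ)) :=
      IsCoprime.prod_right fun j hj =>
        Nat.isCoprime_iff_coprime.2 (hcop i j (Finset.mem_erase.1 hj).1.symm)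
    have h4 : u i ∣ 2 * D i := by exact_mod_cast h3.dvd_of_dvd_mul_right h2
    by_contra hodd
    have h5 : Nat.Coprime (u i) 2 := ((Nat.Prime.coprime_iff_not_dvd Nat.prime_two).2 hodd).symm
    exact absurd (Nat.le_of_dvd (hD i) (h5.dvd_of_dvd_mul_left h4)) (hDu i).not_ge
  have h6 := Nat.dvd_gcd (heven ⟨0, by omega⟩) (heven ⟨1, by omega⟩)
  rw [hcop ⟨0, by omega⟩ ⟨1, by omega⟩ (by simp)] at h6
  omega

end Residue

section Window

lemma sum_pow_pred_lt {u : ℕ} (hu : 2 ≤ u) {S : Finset ℕ} (h1 : ∀ q ∈ S, 1 ≤ q) {n : ℕ}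
    (hn : ∀ q ∈ S, q ≤ n) : ∑ q ∈ S, u ^ (q - 1) < u ^ n := by
  have hinj : Set.InjOn (fun q => q - 1) (S : Set ℕ) := fun a ha b hb h => by
    have := h1 a ha
    have := h1 b hb
    simp only at h
    omega
  rw [← Finset.sum_image (f := fun k => u ^ k) hinj]
  refine Nat.geomSum_lt hu fun k hk => ?_
  obtain ⟨q, hq, rfl⟩ := Finset.mem_image.1 hk
  have := h1 q hq
  have := hn q hq
  omega

lemma sum_pow_pred_mod {u : ℕ} (hu : 2 ≤ u) {S : Finset ℕ} (h1 : ∀ q ∈ S, 1 ≤ q)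
    (hgap : ∀ q ∈ S, ∀ q' ∈ S, q < q' → q + 2 ≤ q') {r : ℕ} (hr : r ∈ S) :
    u ^ (r - 1) ≤ (∑ q ∈ S, u ^ (q - 1)) % u ^ (r + 1) ∧
      (∑ q ∈ S, u ^ (q - 1)) % u ^ (r + 1) < u ^ r := by
  have hlt : ∑ q ∈ S with q ≤ r, u ^ (q - 1) < u ^ r :=
    sum_pow_pred_lt hu (fun q hq => h1 q (Finset.mem_filter.1 hq).1)
      fun q hq => (Finset.mem_filter.1 hq).2
  have hdvd : u ^ (r + 1) ∣ ∑ q ∈ S with ¬ q ≤ r, u ^ (q - 1) := by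
    refine Finset.dvd_sum fun q hq => pow_dvd_pow u ?_
    rw [Finset.mem_filter, not_le] at hq
    have := hgap r hr q hq.1 hq.2
    omega
  have hmod : (∑ q ∈ S, u ^ (q - 1)) % u ^ (r + 1) = ∑ q ∈ S with q ≤ r, u ^ (q - 1) := by
    rw [← Finset.sum_filter_add_sum_filter_not S (· ≤ r), Nat.add_mod,
      Nat.mod_eq_zero_of_dvd hdvd, add_zero, Nat.mod_mod, Nat.mod_eq_of_lt]
    exact hlt.trans (Nat.pow_lt_pow_right (by omega) (by omega))
  rw [hmod]
  exact ⟨Finset.single_le_sum (f := fun q => u ^ (q - 1)) (fun _ _ => Nat.zero_le _)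
    (Finset.mem_filter.2 ⟨hr, le_rfl⟩), hlt⟩

variable {s : ℕ} {u : Fin s → ℕ}

/-- Averaging over all window lengths, when the common residue is not half the modulus. -/
lemma exists_window_of_two_mul_ne (hs : 1 ≤ s) (hu : ∀ i, 2 ≤ u i) {T : ℕ} {S : Fin s → Finset ℕ}
    (hS : ∀ i, S i ⊆ Finset.range T) (h1 : ∀ i, ∀ r ∈ S i, 1 ≤ r) {κ : ℕ} (hκ : κ < ∏ i, u i)
    (hne : 2 * κ ≠ ∏ i, u i) :
    ∃ N ≤ (∏ i, u i) ^ T, ((∏ i, #(S i) : ℕ) : ℝ) / (4 * (∏ i, u i : ℕ)) ≤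
      |∑ r ∈ Fintype.piFinset S, ((#{j ∈ Finset.range N |
        j % ∏ i, u i ^ (r i + 1) = κ * ∏ i, u i ^ r i} : ℝ)
          - N / (∏ i, u i ^ (r i + 1) : ℕ))| := by
  set P := ∏ i, u i with hP
  have hP0 : 0 < P := by omega
  have hP0' : (0 : ℝ) < P := by exact_mod_cast hP0
  obtain ⟨ε, hε, hεP⟩ : ∃ ε : ℝ, |ε| = 1 ∧ 1 ≤ ε * ((P : ℝ) - 2 * κ) := by
    rcases lt_or_gt_of_ne hne with h | h
    · refine ⟨1, abs_one, ?_⟩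
      have : (2 * κ + 1 : ℝ) ≤ P := by exact_mod_cast h
      linarith
    · refine ⟨-1, by simp, ?_⟩
      have : (P + 1 : ℝ) ≤ 2 * κ := by exact_mod_cast h
      linarith
  have hterm : ∀ r ∈ Fintype.piFinset S, ((P ^ T : ℕ) : ℝ) / (4 * P) ≤
      ε * ∑ N ∈ Finset.range (P ^ T), ((#{j ∈ Finset.range N |
        j % ∏ i, u i ^ (r i + 1) = κ * ∏ i, u i ^ r i} : ℝ)
          - N / (∏ i, u i ^ (r i + 1) : ℕ)) := by
    intro r hr
    rw [Fintype.mem_piFinset] at hr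
    set G := ∏ i, u i ^ r i with hG
    have hM : ∏ i, u i ^ (r i + 1) = P * G := by
      simp only [pow_succ, Finset.prod_mul_distrib]
      rw [mul_comm]
    obtain ⟨K, hK⟩ : P * G ∣ P ^ T := by
      rw [← hM, hP, ← Finset.prod_pow]
      exact Finset.prod_dvd_prod_of_dvd _ _ fun i _ =>
        pow_dvd_pow _ (Finset.mem_range.1 (hS i (hr i)))
    have hG2 : 2 ≤ G := by
      have hpos : 0 < G := Finset.prod_pos fun i _ => pow_pos (by have := hu i; omega) _
      refine (hu ⟨0, hs⟩).trans (Nat.le_of_dvd hpos ?_)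
      exact (dvd_pow_self _ (by have := h1 _ _ (hr ⟨0, hs⟩); omega)).trans
        (Finset.dvd_prod_of_mem (fun i => u i ^ r i) (Finset.mem_univ (⟨0, hs⟩ : Fin s)))
    have hG2' : (2 : ℝ) ≤ G := by exact_mod_cast hG2
    have hx : κ * G < P * G := Nat.mul_lt_mul_of_pos_right hκ (by omega)
    rw [hM, hK, sum_card_filter_mod_sub hx]
    push_cast
    have h3 : (P * G * K : ℝ) / (4 * P) = K * (G / 4) := by field_simp
    have h4 : ε * (K * ((P * G - 1) / 2 - κ * G) : ℝ)
        = K * ((ε * (P - 2 * κ) * G - ε) / 2) := by ring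
    rw [h3, h4]
    have h5 : ε ≤ 1 := hε ▸ le_abs_self ε
    have h6 : (G : ℝ) ≤ ε * (P - 2 * κ) * G := le_mul_of_one_le_left (by linarith) hεP
    exact mul_le_mul_of_nonneg_left (by linarith) (Nat.cast_nonneg K)
  have hsum : ∑ N ∈ Finset.range (P ^ T), ((∏ i, #(S i) : ℕ) : ℝ) / (4 * P) ≤
      ∑ N ∈ Finset.range (P ^ T), ε * ∑ r ∈ Fintype.piFinset S, ((#{j ∈ Finset.range N |
        j % ∏ i, u i ^ (r i + 1) = κ * ∏ i, u i ^ r i} : ℝ)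
          - N / (∏ i, u i ^ (r i + 1) : ℕ)) := by
    rw [← Finset.mul_sum, Finset.sum_comm, Finset.mul_sum, Finset.sum_const, Finset.card_range,
      ← Fintype.card_piFinset]
    refine le_trans (le_of_eq ?_) (Finset.sum_le_sum hterm)
    rw [Finset.sum_const, nsmul_eq_mul, nsmul_eq_mul]
    ring
  obtain ⟨N, hN, hle⟩ := Finset.exists_le_of_sum_le
    (Finset.nonempty_range_iff.2 (pow_pos hP0 T).ne') hsum
  refine ⟨N, (Finset.mem_range.1 hN).le, hle.trans ?_⟩
  refine (le_abs_self _).trans ?_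
  rw [abs_mul, hε, one_mul]

/-- A single window length that works in dimension one for every residue `κ ≠ 0`. -/
lemma exists_window_dim_one {u κ T : ℕ} (hu : 2 ≤ u) (hκ0 : 0 < κ) (hκ : κ < u) {S : Finset ℕ}
    (hS : S ⊆ Finset.range T) (h1 : ∀ r ∈ S, 1 ≤ r)
    (hgap : ∀ q ∈ S, ∀ q' ∈ S, q < q' → q + 2 ≤ q') :
    ∃ N ≤ u ^ T, (#S : ℝ) / u ^ 2 ≤ |∑ r ∈ S, ((#{j ∈ Finset.range N |
        j % u ^ (r + 1) = κ * u ^ r} : ℝ) - N / (u ^ (r + 1) : ℕ))| := by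
  have hu0 : (0 : ℝ) < u := by exact_mod_cast (by omega : 0 < u)
  refine ⟨∑ q ∈ S, u ^ (q - 1),
    (sum_pow_pred_lt hu h1 fun q hq => (Finset.mem_range.1 (hS hq)).le).le, ?_⟩
  have hterm : ∀ r ∈ S, (1 : ℝ) / u ^ 2 ≤ -((#{j ∈ Finset.range (∑ q ∈ S, u ^ (q - 1)) |
      j % u ^ (r + 1) = κ * u ^ r} : ℝ) - (∑ q ∈ S, u ^ (q - 1) : ℕ) / (u ^ (r + 1) : ℕ)) := by
    intro r hr
    obtain ⟨h2, h3⟩ := sum_pow_pred_mod hu h1 hgap hr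
    have hx : κ * u ^ r < u ^ (r + 1) := by
      rw [pow_succ']
      exact Nat.mul_lt_mul_of_pos_right hκ (pow_pos (by omega) r)
    have h4 : u ^ r ≤ κ * u ^ r := Nat.le_mul_of_pos_left _ hκ0
    rw [card_filter_mod_sub hx, if_neg (by omega), zero_sub, neg_neg,
      div_le_div_iff₀ (by positivity) (by positivity), one_mul]
    have h5 : u ^ (r + 1) = u ^ (r - 1) * u ^ 2 := by
      rw [← pow_add]
      congr 1
      have := h1 r hr
      omega
    have h6 : u ^ (r + 1) ≤ ((∑ q ∈ S, u ^ (q - 1)) % u ^ (r + 1)) * u ^ 2 := by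
      conv_lhs => rw [h5]
      exact Nat.mul_le_mul_right _ h2
    exact_mod_cast h6
  refine le_trans ?_ (neg_le_abs _)
  rw [← Finset.sum_neg_distrib]
  refine le_trans (le_of_eq ?_) (Finset.sum_le_sum hterm)
  rw [Finset.sum_const, nsmul_eq_mul]
  ring

lemma exists_window (hs : 1 ≤ s) (hu : ∀ i, 2 ≤ u i)
    (hcop : ∀ i j, i ≠ j → Nat.Coprime (u i) (u j)) {T : ℕ} {S : Fin s → Finset ℕ}
    (hS : ∀ i, S i ⊆ Finset.range T) (h1 : ∀ i, ∀ r ∈ S i, 1 ≤ r)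
    (hgap : ∀ i, ∀ q ∈ S i, ∀ q' ∈ S i, q < q' → q + 2 ≤ q')
    {D : Fin s → ℕ} (hD : ∀ i, 0 < D i) (hDu : ∀ i, D i < u i) {κ : ℕ} (hκ : κ < ∏ i, u i)
    (hκD : ∀ i, (u i : ℤ) ∣ κ - D i * ∏ j ∈ univ.erase i, (u j : ℤ)) :
    ∃ N ≤ (∏ i, u i) ^ T, ((∏ i, #(S i) : ℕ) : ℝ) / (4 * (∏ i, u i : ℕ) ^ 2) ≤
      |∑ r ∈ Fintype.piFinset S, ((#{j ∈ Finset.range N |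
        j % ∏ i, u i ^ (r i + 1) = κ * ∏ i, u i ^ r i} : ℝ)
          - N / (∏ i, u i ^ (r i + 1) : ℕ))| := by
  have hP1 : (1 : ℝ) ≤ (∏ i, u i : ℕ) := by exact_mod_cast (by omega : 1 ≤ ∏ i, u i)
  by_cases hne : 2 * κ = ∏ i, u i
  · have hs1 : s = 1 := by
      by_contra h
      exact two_mul_ne_prod hcop (by omega) hD hDu hκD hne
    subst hs1
    simp only [Finset.univ_unique, Fin.default_eq_zero, Finset.prod_singleton] at *
    obtain ⟨N, hN, hle⟩ := exists_window_dim_one (hu 0) (by omega) hκ (hS 0) (h1 0) (hgap 0)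
    refine ⟨N, hN, le_trans ?_ (hle.trans (le_of_eq ?_))⟩
    · gcongr
      nlinarith
    · congr 1
      refine Finset.sum_bij (fun r _ => fun _ => r) (fun r hr => ?_) (fun a _ b _ h => ?_)
        (fun b hb => ?_) fun r _ => rfl
      · rw [Fintype.mem_piFinset]
        intro i
        rwa [Subsingleton.elim i 0]
      · exact congrFun h 0
      · refine ⟨b 0, Fintype.mem_piFinset.1 hb 0, funext fun i => ?_⟩
        rw [Subsingleton.elim i 0]
  · obtain ⟨N, hN, hle⟩ := exists_window_of_two_mul_ne hs hu hS h1 hκ hne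
    refine ⟨N, hN, le_trans ?_ hle⟩
    gcongr
    nlinarith

end Window

section StarDiscrepancy

variable {s : ℕ}

lemma card_filter_range_div_le_one (N : ℕ) (p : ℕ → Prop) [DecidablePred p] :
    (#{n ∈ Finset.range N | p n} : ℝ) / N ≤ 1 := by
  refine div_le_one_of_le₀ ?_ (Nat.cast_nonneg N)
  exact_mod_cast (Finset.card_filter_le _ _).trans_eq (Finset.card_range N)

lemma starDisc_set_eq (N : ℕ) (x : ℕ → Fin s → ℝ) (y : Fin s → ℝ) :
    Nat.card {n : ℕ | n < N ∧ ∀ i, x n i < y i} = #{n ∈ Finset.range N | ∀ i, x n i < y i} := by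
  rw [Nat.card_coe_set_eq, ← Set.ncard_coe_finset]
  congr 1
  ext n
  simp

lemma starDisc_term_le_one (N : ℕ) (x : ℕ → Fin s → ℝ) {y : Fin s → ℝ}
    (hy : ∀ i, y i ∈ Set.Ioc (0 : ℝ) 1) :
    |(Nat.card {n : ℕ | n < N ∧ ∀ i, x n i < y i} : ℝ) / N - ∏ i, y i| ≤ 1 := by
  rw [starDisc_set_eq]
  have h1 := card_filter_range_div_le_one N fun n => ∀ i, x n i < y i
  have h2 : 0 ≤ ∏ i, y i := Finset.prod_nonneg fun i _ => (hy i).1.le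
  have h3 : ∏ i, y i ≤ 1 := Finset.prod_le_one (fun i _ => (hy i).1.le) fun i _ => (hy i).2
  have h4 : (0 : ℝ) ≤ (#{n ∈ Finset.range N | ∀ i, x n i < y i} : ℝ) / N := by positivity
  rw [abs_le]
  constructor <;> linarith

lemma mul_starDisc_le (N : ℕ) (x : ℕ → Fin s → ℝ) : (N : ℝ) * starDisc s N x ≤ N := by
  refine mul_le_of_le_one_right (Nat.cast_nonneg N) (csSup_le ⟨_, fun _ => 1, by simp, rfl⟩ ?_)
  rintro d ⟨y, hy, rfl⟩
  exact starDisc_term_le_one N x hy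

lemma abs_card_sub_le_mul_starDisc (N : ℕ) (x : ℕ → Fin s → ℝ) {y : Fin s → ℝ}
    (hy : ∀ i, y i ∈ Set.Ioc (0 : ℝ) 1) :
    |(#{n ∈ Finset.range N | ∀ i, x n i < y i} : ℝ) - N * ∏ i, y i| ≤ N * starDisc s N x := by
  rcases Nat.eq_zero_or_pos N with rfl | hN
  · simp
  have hN' : (0 : ℝ) < N := by exact_mod_cast hN
  have h1 : |(Nat.card {n : ℕ | n < N ∧ ∀ i, x n i < y i} : ℝ) / N - ∏ i, y i|
      ≤ starDisc s N x := by
    refine le_csSup ⟨1, ?_⟩ ⟨y, hy, rfl⟩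
    rintro d ⟨y, hy, rfl⟩
    exact starDisc_term_le_one N x hy
  rw [starDisc_set_eq] at h1
  refine le_trans (le_of_eq ?_) (mul_le_mul_of_nonneg_left h1 hN'.le)
  rw [← abs_of_pos hN', ← abs_mul, abs_of_pos hN', mul_sub, mul_div_cancel₀ _ hN'.ne']

end StarDiscrepancy

section Halton

variable {s : ℕ} {u v : Fin s → ℕ} {σ : Fin s → ℕ → ℕ → ℕ} (hu : ∀ i, 2 ≤ u i)
  (hσ : ∀ i r, Set.BijOn (σ i r) (Set.Iio (u i)) (Set.Iio (u i)))

include hu hσ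

lemma card_revInt_lt_sub_eq_sum {S : Fin s → Finset ℕ} {T : ℕ}
    (hS : ∀ i, S i ⊆ Finset.range T) (W N : ℕ) :
    (#{j ∈ Finset.range N | ∀ i, revInt (u i) (v i) (σ i) (W + j) T < cornerInt (u i) (S i) T} : ℝ)
        - N * ∏ i, ((cornerInt (u i) (S i) T : ℝ) / (u i) ^ T)
      = ∑ r ∈ Fintype.piFinset S, ((#{j ∈ Finset.range N |
        ∀ i, revInt (u i) (v i) (σ i) (W + j) (r i + 1) = u i * cornerInt (u i) (S i) (r i)} : ℝ)
          - N / (∏ i, u i ^ (r i + 1) : ℕ)) := by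
  rw [Finset.sum_sub_distrib]
  congr 1
  · simp only [Finset.natCast_card_filter]
    rw [Finset.sum_comm]
    refine Finset.sum_congr rfl fun j _ => ?_
    have h1 : ∀ p : Fin s → Prop, ∀ [DecidablePred p],
        (if ∀ i, p i then (1 : ℝ) else 0) = ∏ i, if p i then 1 else 0 := by
      intro p _
      rw [Fintype.prod_ite_zero, Finset.prod_const_one]
      congr
    simp only [h1, indicator_revInt_lt (hu _) (hσ _) (hS _)]
    rw [Finset.prod_univ_sum]
  · simp only [div_eq_mul_inv (N : ℝ)]
    rw [← Finset.mul_sum]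
    congr 1
    simp only [fun i => cornerInt_div (show 0 < u i by have := hu i; omega) (hS i)]
    rw [Finset.prod_univ_sum]
    refine Finset.sum_congr rfl fun r _ => ?_
    push_cast
    rw [← Finset.prod_inv_distrib]
    simp

lemma exists_revInt_eq (huv : ∀ i, Nat.Coprime (u i) (v i))
    (hcop : ∀ i j, i ≠ j → Nat.Coprime (u i) (u j)) {T : ℕ} {Y : Fin s → ℕ}
    (hY : ∀ i, Y i < u i ^ T) :
    ∃ W < (∏ i, u i) ^ T, ∀ i, revInt (u i) (v i) (σ i) W T = Y i := by
  have hu0 : ∀ i, 0 < u i := fun i => by have := hu i; omega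
  let f : Fin ((∏ i, u i) ^ T) → ∀ i, Fin (u i ^ T) := fun W i =>
    ⟨revInt (u i) (v i) (σ i) W T, revInt_lt (hu0 i) (hσ i) W T⟩
  have hf : Function.Bijective f := by
    rw [Fintype.bijective_iff_injective_and_card]
    refine ⟨fun W W' h => ?_, by simp [Finset.prod_pow]⟩
    have h1 : ∀ i, (u i : ℤ) ^ T ∣ (W : ℕ) - ((W' : ℕ) : ℤ) := fun i =>
      (revInt_eq_iff (hu0 i) (hσ i) (huv i) _ _ _).1 (congrArg Fin.val (congrFun h i))
    have h2 : ∏ i, (u i : ℤ) ^ T ∣ (W : ℕ) - ((W' : ℕ) : ℤ) :=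
      Fintype.prod_dvd_of_coprime (fun i l hil => natCast_isCoprime_pow (hcop i l hil) _ _) h1
    rw [Finset.prod_pow] at h2
    have h3 : ((W : ℕ) : ℤ) < (∏ i, (u i : ℤ)) ^ T := by exact_mod_cast W.2
    have h4 : ((W' : ℕ) : ℤ) < (∏ i, (u i : ℤ)) ^ T := by exact_mod_cast W'.2
    have h5 := Int.eq_zero_of_abs_lt_dvd h2 (by rw [abs_lt]; constructor <;> linarith [h3, h4])
    exact Fin.ext (by omega)
  obtain ⟨W, hW⟩ := hf.2 fun i => ⟨Y i, hY i⟩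
  exact ⟨W, W.2, fun i => congrArg Fin.val (congrFun hW i)⟩

/-- Truncating the radical inverse functions changes the count in a box by at most the dimension. -/
lemma abs_card_ratPhi_sub_card_revInt_le (huv : ∀ i, Nat.Coprime (u i) (v i)) (T N : ℕ)
    (Y : Fin s → ℕ) :
    |(#{n ∈ Finset.range N | ∀ i, ratPhi (u i) (v i) (σ i) n < (Y i : ℝ) / u i ^ T} : ℝ)
      - #{n ∈ Finset.range N | ∀ i, revInt (u i) (v i) (σ i) n T < Y i}| ≤ s := by
  have hu0 : ∀ i, 0 < u i := fun i => by have := hu i; omega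
  have hu0' : ∀ i, (0 : ℝ) < u i := fun i => by exact_mod_cast hu0 i
  set A := {n ∈ Finset.range N | ∀ i, ratPhi (u i) (v i) (σ i) n < (Y i : ℝ) / u i ^ T} with hA
  set B := {n ∈ Finset.range N | ∀ i, revInt (u i) (v i) (σ i) n T < Y i} with hB
  have hAB : A ⊆ B := by
    intro n hn
    rw [hA, Finset.mem_filter] at hn
    rw [hB, Finset.mem_filter]
    refine ⟨hn.1, fun i => ?_⟩
    have h := (le_ratPhi (hu0 i) (hσ i) (v := v i) n T).trans_lt (hn.2 i)
    rw [div_lt_div_iff_of_pos_right (pow_pos (hu0' i) T)] at h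
    exact_mod_cast h
  have hsub : B \ A ⊆ univ.biUnion fun i => {n ∈ Finset.range N |
      revInt (u i) (v i) (σ i) n T < Y i ∧ (Y i : ℝ) / u i ^ T ≤ ratPhi (u i) (v i) (σ i) n} := by
    intro n hn
    simp only [hA, hB, Finset.mem_sdiff, Finset.mem_filter, not_and, not_forall, not_lt] at hn
    obtain ⟨i, hi⟩ := hn.2 hn.1.1
    exact Finset.mem_biUnion.2
      ⟨i, Finset.mem_univ i, Finset.mem_filter.2 ⟨hn.1.1, hn.1.2 i, hi⟩⟩
  have hcard : #(B \ A) ≤ s := by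
    refine (Finset.card_le_card hsub).trans ?_
    refine (Finset.card_biUnion_le_card_mul _ _ 1 fun i _ => ?_).trans (by simp)
    refine Finset.card_le_one.2 fun n hn m hm => ?_
    rw [Finset.mem_filter] at hn hm
    exact eq_of_ratPhi_ge (hu0 i) (hσ i) (hu i) (huv i) hn.2.1 hn.2.2 hm.2.1 hm.2.2
  have h1 : (#B : ℝ) = #(B \ A) + #A := by
    exact_mod_cast (Finset.card_sdiff_add_card_eq_card hAB).symm
  have h2 : (#(B \ A) : ℝ) ≤ s := by exact_mod_cast hcard
  rw [h1, abs_le]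
  constructor <;> linarith [Nat.cast_nonneg (α := ℝ) #(B \ A)]

end Halton

section Assembly

lemma exists_positions {u τ K L : ℕ} (hτ : 0 < τ) (hu : 0 < u) (hL : u * K ≤ L) {f : ℕ → ℕ}
    (hf : ∀ r, f r < u) :
    ∃ S ⊆ Finset.range (τ * L), ∃ d, K ≤ #S ∧ ∀ r ∈ S, τ ∣ r + 1 ∧ f r = d := by
  obtain ⟨d, -, hd⟩ := Finset.exists_le_card_fiber_of_mul_le_card_of_maps_to
    (s := Finset.range L) (t := Finset.range u) (f := fun k => f (τ * (k + 1) - 1)) (n := K)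
    (fun k _ => Finset.mem_range.2 (hf _)) ⟨0, Finset.mem_range.2 hu⟩ (by simpa using hL)
  have hpos : ∀ k, 0 < τ * (k + 1) := fun k => Nat.mul_pos hτ k.succ_pos
  have hinj : Function.Injective fun k => τ * (k + 1) - 1 := by
    intro a b h
    have h1 : τ * (a + 1) = τ * (b + 1) := by
      have := hpos a
      have := hpos b
      simp only at h
      omega
    have := Nat.eq_of_mul_eq_mul_left hτ h1
    omega
  refine ⟨{k ∈ Finset.range L | f (τ * (k + 1) - 1) = d}.image fun k => τ * (k + 1) - 1,
    fun r hr => ?_, d, ?_, fun r hr => ?_⟩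
  · obtain ⟨k, hk, rfl⟩ := Finset.mem_image.1 hr
    have h1 := Finset.mem_range.1 (Finset.mem_filter.1 hk).1
    have h2 : τ * (k + 1) ≤ τ * L := Nat.mul_le_mul_left τ h1
    have := hpos k
    exact Finset.mem_range.2 (by omega)
  · rwa [Finset.card_image_of_injective _ hinj]
  · obtain ⟨k, hk, rfl⟩ := Finset.mem_image.1 hr
    rw [Nat.sub_add_cancel (hpos k)]
    exact ⟨dvd_mul_right _ _, (Finset.mem_filter.1 hk).2⟩

lemma pow_modEq_one_of_totient_dvd {a b n : ℕ} (h : Nat.Coprime a b) (hn : b.totient ∣ n) :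
    (a : ℤ) ^ n ≡ 1 [ZMOD b] := by
  obtain ⟨c, rfl⟩ := hn
  rw [pow_mul]
  have h1 := (Int.natCast_modEq_iff.2 (Nat.ModEq.pow_totient h)).pow c
  push_cast at h1
  rwa [one_pow] at h1

variable {s : ℕ} {u v : Fin s → ℕ} {σ : Fin s → ℕ → ℕ → ℕ}

lemma exists_starDisc_ge (hs : 1 ≤ s) (hu : ∀ i, 2 ≤ u i)
    (huv : ∀ i, Nat.Coprime (u i) (v i))
    (hcop : ∀ i j, i ≠ j → Nat.Coprime (u i) (u j))
    (hσ : ∀ i r, Set.BijOn (σ i r) (Set.Iio (u i)) (Set.Iio (u i))) {K : ℕ} (hK : 1 ≤ K) :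
    ∃ N ≤ 2 * (∏ i, u i) ^ (2 * (∏ i, (u i).totient) * (K * ∏ i, u i)),
      (K : ℝ) ^ s / (8 * (∏ i, u i : ℕ) ^ 2) ≤
        N * starDisc s N (fun n i => ratPhi (u i) (v i) (σ i) n) + s := by
  have hu0 : ∀ i, 0 < u i := fun i => by have := hu i; omega
  set P := ∏ i, u i with hP
  set τ := 2 * ∏ i, (u i).totient with hτ
  set T := τ * (K * P) with hT
  have hP0 : 0 < P := Finset.prod_pos fun i _ => hu0 i
  have hτ2 : 2 ≤ τ := by
    have : 0 < ∏ i, (u i).totient := Finset.prod_pos fun i _ => Nat.totient_pos.2 (hu0 i)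
    omega
  have hτdvd : ∀ i, (u i).totient ∣ τ := fun i =>
    (Finset.dvd_prod_of_mem (fun i => (u i).totient) (Finset.mem_univ i)).mul_left 2
  choose f hf0 hfu a b ha hb ha0 hb1 hfD using fun i => exists_digit_jump (hu i) (hσ i)
  have hpos : ∀ i, ∃ S ⊆ Finset.range T, ∃ d, K ≤ #S ∧ ∀ r ∈ S, τ ∣ r + 1 ∧ f i r = d := by
    intro i
    refine exists_positions (by omega) (hu0 i) ?_ (hfu i)
    rw [mul_comm]
    exact Nat.mul_le_mul_left K (Nat.le_of_dvd hP0 (Finset.dvd_prod_of_mem u (Finset.mem_univ i)))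
  choose S hS D hSK hSD using hpos
  have hSne : ∀ i, (S i).Nonempty := fun i => Finset.card_pos.1 (hK.trans (hSK i))
  have hD0 : ∀ i, 0 < D i := fun i => by
    obtain ⟨r, hr⟩ := hSne i
    rw [← (hSD i r hr).2]
    exact hf0 i r
  have hDu : ∀ i, D i < u i := fun i => by
    obtain ⟨r, hr⟩ := hSne i
    rw [← (hSD i r hr).2]
    exact hfu i r
  have h1 : ∀ i, ∀ r ∈ S i, 1 ≤ r := fun i r hr => by
    have := Nat.le_of_dvd r.succ_pos (hSD i r hr).1
    omega
  have hgap : ∀ i, ∀ q ∈ S i, ∀ q' ∈ S i, q < q' → q + 2 ≤ q' := fun i q hq q' hq' h => by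
    have h2 := Nat.dvd_sub (hSD i q' hq').1 (hSD i q hq).1
    have h3 := Nat.le_of_dvd (by omega) h2
    omega
  obtain ⟨κ, hκ, hκD⟩ := exists_common_numerator hu0 D
  obtain ⟨N, hN, hle⟩ := exists_window hs hu hcop hS h1 hgap hD0 hDu hκ hκD
  obtain ⟨W, hW, hWY⟩ := exists_revInt_eq hu hσ huv hcop
    fun i => cornerInt_lt (hu i) (S i) T
  rw [← hP] at hN hle hW
  set Y := fun i => cornerInt (u i) (S i) T with hY
  set B : ℕ → Prop := fun n => ∀ i, revInt (u i) (v i) (σ i) n T < Y i with hB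
  have hBdec : DecidablePred B := fun n => by rw [hB]; infer_instance
  set V := ∏ i, ((Y i : ℝ) / (u i) ^ T) with hV
  have hboxes : ∀ r ∈ Fintype.piFinset S, ∀ j : ℕ,
      (∀ i, revInt (u i) (v i) (σ i) (W + j) (r i + 1) = u i * cornerInt (u i) (S i) (r i)) ↔
        j % ∏ i, u i ^ (r i + 1) = κ * ∏ i, u i ^ r i := by
    intro r hr j
    rw [Fintype.mem_piFinset] at hr
    rw [← mod_prod_eq_iff hcop hκ hκD]
    · refine forall_congr' fun i => ?_
      refine revInt_add_eq_iff (hu i) (hσ i) (huv i) (hWY i) (Finset.mem_range.1 (hS i (hr i)))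
        (hr i) ?_ (ha i _) (hb i _) (ha0 i _) (hb1 i _) ?_ j
      · exact pow_modEq_one_of_totient_dvd (huv i).symm ((hτdvd i).trans (hSD i _ (hr i)).1)
      · rw [← (hSD i _ (hr i)).2]
        exact hfD i _
    · intro i l hil
      exact pow_modEq_one_of_totient_dvd (hcop i l hil).symm
        ((hτdvd i).trans (hSD l _ (hr l)).1)
  have hwin : ((∏ i, #(S i) : ℕ) : ℝ) / (4 * (P : ℕ) ^ 2) ≤
      |(#{j ∈ Finset.range N | B (W + j)} : ℝ) - N * V| := by
    refine hle.trans (le_of_eq ?_)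
    have h2 := card_revInt_lt_sub_eq_sum (v := v) hu hσ hS W N
    refine congrArg abs (Eq.trans ?_ (Eq.trans ?_ h2).symm)
    swap
    · congr!
    refine Finset.sum_congr rfl fun r hr => ?_
    rw [Finset.filter_congr fun j _ => hboxes r hr j]
  have hsplit : (#{n ∈ Finset.range (W + N) | B n} : ℝ)
      = #{n ∈ Finset.range W | B n} + #{j ∈ Finset.range N | B (W + j)} := by
    simp only [Finset.natCast_card_filter]
    exact Finset.sum_range_add _ _ _
  have hKS : (K : ℝ) ^ s ≤ (∏ i, #(S i) : ℕ) := by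
    have : K ^ s ≤ ∏ i, #(S i) := by
      simpa using Finset.prod_le_prod' (s := univ) (f := fun _ : Fin s => K) fun i _ => hSK i
    exact_mod_cast this
  have hlarge : ∃ L ≤ W + N, (K : ℝ) ^ s / (8 * (P : ℕ) ^ 2) ≤
      |(#{n ∈ Finset.range L | B n} : ℝ) - L * V| := by
    by_contra! hcon
    have h2 := hcon (W + N) le_rfl
    have h3 := hcon W (Nat.le_add_right _ _)
    have h4 : (#{j ∈ Finset.range N | B (W + j)} : ℝ) - N * V
        = ((#{n ∈ Finset.range (W + N) | B n} : ℝ) - (W + N : ℕ) * V)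
          - ((#{n ∈ Finset.range W | B n} : ℝ) - W * V) := by
      rw [hsplit]
      push_cast
      ring
    rw [h4] at hwin
    have h5 := hwin.trans (abs_sub _ _)
    have h6 : (K : ℝ) ^ s / (4 * (P : ℕ) ^ 2) ≤ ((∏ i, #(S i) : ℕ) : ℝ) / (4 * (P : ℕ) ^ 2) := by
      gcongr
    have h7 : (K : ℝ) ^ s / (4 * (P : ℕ) ^ 2) = 2 * ((K : ℝ) ^ s / (8 * (P : ℕ) ^ 2)) := by
      ring
    linarith
  obtain ⟨L, hL, hLle⟩ := hlarge
  refine ⟨L, by omega, hLle.trans ?_⟩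
  have hy : ∀ i, (Y i : ℝ) / u i ^ T ∈ Set.Ioc (0 : ℝ) 1 := by
    intro i
    have hui : (0 : ℝ) < u i := by exact_mod_cast hu0 i
    constructor
    · rw [hY]
      simp only
      rw [cornerInt_div (hu0 i) (hS i)]
      exact Finset.sum_pos (fun _ _ => by positivity) (hSne i)
    · rw [div_le_one (by positivity)]
      exact_mod_cast (cornerInt_lt (hu i) (S i) T).le
  have h2 := abs_card_sub_le_mul_starDisc L (fun n i => ratPhi (u i) (v i) (σ i) n) hy
  have h3 := abs_card_ratPhi_sub_card_revInt_le hu hσ huv T L Y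
  have hsub : ∀ {a b x d e : ℝ}, |a - x| ≤ d → |a - b| ≤ e → |b - x| ≤ d + e := by
    intro a b x d e hd he
    rw [abs_sub_comm] at he
    exact (abs_sub_le b a x).trans (by linarith)
  exact hsub h2 (by convert h3)

end Assembly

/-- **Theorem 1.** For the `s`-dimensional generalized Halton sequence in rational bases
`(u_1/v_1,…,u_s/v_s)`, `limsup_{N→∞} N·D*_N/(log N)^s > 0`: there is `c > 0` with
`N·D*_N ≥ c·(log N)^s` for infinitely many `N`. -/
theorem star_discrepancy_lower_bound_generalized_halton_rational_bases
    (s : ℕ) (hs : 1 ≤ s) (u v : Fin s → ℕ)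
    (hu : ∀ i, 2 ≤ u i) (hv : ∀ i, 1 ≤ v i)
    (huv : ∀ i, Nat.Coprime (u i) (v i))
    (hcop : ∀ i j, i ≠ j → Nat.Coprime (u i) (u j))
    (σ : Fin s → ℕ → ℕ → ℕ)
    (hσ : ∀ i r, Set.BijOn (σ i r) (Set.Iio (u i)) (Set.Iio (u i))) :
    ∃ c : ℝ, 0 < c ∧ ∀ N₀ : ℕ, ∃ N : ℕ, N₀ ≤ N ∧
      c * (Real.log N) ^ s ≤
        (N : ℝ) * starDisc s N (fun n i => ratPhi (u i) (v i) (σ i) n) := by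
  set P := ∏ i, u i with hP
  set τ := 2 * ∏ i, (u i).totient with hτ
  have hP0 : 0 < P := Finset.prod_pos fun i _ => two_pos.trans_le (hu i)
  have hP1 : 1 ≤ P := hP0
  have hP1' : (1 : ℝ) ≤ P := by exact_mod_cast hP1
  set A : ℝ := Real.log 2 + τ * P * Real.log P with hA
  have hA0 : 0 < A := by
    have := Real.log_pos one_lt_two
    have := Real.log_nonneg hP1'
    positivity
  refine ⟨1 / (16 * (P : ℝ) ^ 2 * A ^ s), by positivity, fun N₀ => ?_⟩
  set K := 16 * P ^ 2 * (s + N₀) + 1 with hK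
  have hK1 : (1 : ℝ) ≤ K := by exact_mod_cast (by omega : 1 ≤ K)
  obtain ⟨N, hN, hle⟩ := exists_starDisc_ge hs hu huv hcop hσ (K := K) (by omega)
  rw [← hP, ← hτ] at hN
  rw [← hP] at hle
  have hlarge : (s + N₀ : ℝ) ≤ (K : ℝ) ^ s / (16 * P ^ 2) := by
    rw [le_div_iff₀ (by positivity)]
    calc (s + N₀ : ℝ) * (16 * P ^ 2) ≤ K := by rw [hK]; push_cast; linarith
      _ ≤ (K : ℝ) ^ s := le_self_pow₀ hK1 (by omega)
  have hhalf : (K : ℝ) ^ s / (8 * P ^ 2) = 2 * ((K : ℝ) ^ s / (16 * P ^ 2)) := by ring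
  have hN₀ : (0 : ℝ) ≤ N₀ := Nat.cast_nonneg _
  have hs0 : (0 : ℝ) ≤ s := Nat.cast_nonneg _
  have hdisc := mul_starDisc_le N (fun n i => ratPhi (u i) (v i) (σ i) n)
  have hNN : (N₀ : ℝ) ≤ N := by linarith
  refine ⟨N, by exact_mod_cast hNN, ?_⟩
  have hlog : Real.log N ≤ K * A := by
    rcases Nat.eq_zero_or_pos N with rfl | hpos
    · simp only [Nat.cast_zero, Real.log_zero]
      positivity
    · have hN' : (N : ℝ) ≤ 2 * (P : ℝ) ^ (τ * (K * P)) := by exact_mod_cast hN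
      refine (Real.log_le_log (by exact_mod_cast hpos) hN').trans ?_
      rw [Real.log_mul two_ne_zero (by positivity), Real.log_pow, hA]
      push_cast
      nlinarith [Real.log_pos one_lt_two]
  calc 1 / (16 * (P : ℝ) ^ 2 * A ^ s) * Real.log N ^ s
      ≤ 1 / (16 * (P : ℝ) ^ 2 * A ^ s) * (K * A) ^ s := by
        have := Real.log_natCast_nonneg N
        gcongr
    _ = (K : ℝ) ^ s / (16 * P ^ 2) := by
        rw [mul_pow]
        field_simp
    _ ≤ _ := by linarith
end

section
/- Let u, v, j ∈ ℕ with u ≥ 2 and gcd(u,v) = 1. Let z^(1), z^(2) be integers with formal u/v-adic expansions (a_1^(1), a_2^(1), …) and (a_1^(2), a_2^(2), …) respectively. Then a_r^(1) = a_r^(2) for every 1 ≤ r ≤ j if and only if z^(1) ≡ z^(2) (mod u^j). -/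
open Finset

theorem mul_ratZ_succ (u v : ℕ) (hu : u ≠ 0) (z : ℤ) (r : ℕ) :
    (u : ℤ) * ratZ u v z (r + 1) = v * ratZ u v z r - ratDigit u v z r := by
  have hu' : (u : ℤ) ≠ 0 := by exact_mod_cast hu
  rw [ratDigit, Int.toNat_of_nonneg (Int.emod_nonneg _ hu'), ratZ,
    Int.mul_ediv_cancel' (Int.dvd_self_sub_emod)]

theorem ratDigit_eq_iff_modEq (u v : ℕ) (hu : u ≠ 0) (z₁ z₂ : ℤ) (r : ℕ) :
    ratDigit u v z₁ r = ratDigit u v z₂ r ↔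
      (v : ℤ) * ratZ u v z₁ r ≡ v * ratZ u v z₂ r [ZMOD u] := by
  have hu' : (u : ℤ) ≠ 0 := by exact_mod_cast hu
  have h₁ := Int.emod_nonneg ((v : ℤ) * ratZ u v z₁ r) hu'
  have h₂ := Int.emod_nonneg ((v : ℤ) * ratZ u v z₂ r) hu'
  rw [ratDigit, ratDigit, Int.ModEq]
  omega

theorem pow_mul_ratZ_sub (u v : ℕ) (hu : u ≠ 0) (z₁ z₂ : ℤ) (j : ℕ)
    (h : ∀ r < j, ratDigit u v z₁ r = ratDigit u v z₂ r) :
    (u : ℤ) ^ j * (ratZ u v z₁ j - ratZ u v z₂ j) = (v : ℤ) ^ j * (z₁ - z₂) := by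
  induction j with
  | zero => simp [ratZ]
  | succ j ih =>
    have ih := ih fun r hr => h r (hr.trans j.lt_succ_self)
    have h₁ := mul_ratZ_succ u v hu z₁ j
    have h₂ := mul_ratZ_succ u v hu z₂ j
    rw [h j j.lt_succ_self] at h₁
    linear_combination (u : ℤ) ^ j * (h₁ - h₂) + v * ih

theorem IsCoprime.dvd_mul_left_iff {R : Type*} [CommSemiring R] {a b c : R}
    (h : IsCoprime a b) : a ∣ b * c ↔ a ∣ c :=
  ⟨h.dvd_of_dvd_mul_left, fun hc => hc.mul_left b⟩

theorem forall_lt_ratDigit_eq_iff (u v : ℕ) (hu : u ≠ 0) (huv : Nat.Coprime u v)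
    (z₁ z₂ : ℤ) (j : ℕ) :
    (∀ r < j, ratDigit u v z₁ r = ratDigit u v z₂ r) ↔ (u : ℤ) ^ j ∣ z₁ - z₂ := by
  have hu' : (u : ℤ) ≠ 0 := by exact_mod_cast hu
  have hc : IsCoprime (u : ℤ) v := Nat.isCoprime_iff_coprime.mpr huv
  induction j with
  | zero => simp
  | succ j ih =>
    have step (h : ∀ r < j, ratDigit u v z₁ r = ratDigit u v z₂ r) :
        ratDigit u v z₁ j = ratDigit u v z₂ j ↔ (u : ℤ) ^ (j + 1) ∣ z₁ - z₂ := by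
      rw [ratDigit_eq_iff_modEq u v hu, Int.modEq_comm, Int.modEq_iff_dvd, ← mul_sub,
        hc.dvd_mul_left_iff, ← mul_dvd_mul_iff_left (pow_ne_zero j hu'), ← pow_succ,
        pow_mul_ratZ_sub u v hu z₁ z₂ j h, hc.pow.dvd_mul_left_iff]
    rw [Nat.forall_lt_succ_right]
    constructor
    · rintro ⟨h, hj⟩
      exact (step h).mp hj
    · intro hd
      have h := ih.mpr ((pow_dvd_pow _ j.le_succ).trans hd)
      exact ⟨h, (step h).mpr hd⟩

/-- **Lemma 1.** For coprime `u ≥ 2`, `v ≥ 1`, `j ≥ 1` and integers `z₁, z₂` with formal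
`u/v`-adic expansions `(a_r^{(1)})` and `(a_r^{(2)})`: `a_r^{(1)} = a_r^{(2)}` for all
`1 ≤ r ≤ j` if and only if `z₁ ≡ z₂ (mod u^j)`. -/
theorem ratDigit_eq_iff_modEq_pow
    (u v j : ℕ) (hu : 2 ≤ u) (hv : 1 ≤ v) (hj : 1 ≤ j) (huv : Nat.Coprime u v)
    (z₁ z₂ : ℤ) :
    (∀ r, 1 ≤ r → r ≤ j → ratDigit u v z₁ (r - 1) = ratDigit u v z₂ (r - 1)) ↔
      z₁ ≡ z₂ [ZMOD (u : ℤ) ^ j] := by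
  rw [Int.modEq_comm, Int.modEq_iff_dvd,
    ← forall_lt_ratDigit_eq_iff u v (by omega) huv z₁ z₂ j]
  constructor
  · intro h r hr
    exact h (r + 1) (by omega) hr
  · intro h r hr hrj
    exact h (r - 1) (by omega)
end

section
/- Let u ≥ 2 and v ≥ 1 be coprime integers, Σ = (σ_r)_{r≥1} a sequence of permutations of {0,1,…,u−1}, k ∈ ℕ, and t ∈ ℕ with t ≥ k. Let y = Σ_{j≥1} y_j u^{-j} with y_j ∈ {0,…,u−1} and y_k > 0, and let v̄ ∈ ℕ satisfy v·v̄ ≡ 1 (mod u^k). Let b ∈ {1,…,u−1} be the element with b ≡ σ_k^{-1}(y_k − 1) − σ_k^{-1}(y_k) (mod u). Then for every n ∈ ℕ₀: [φ^Σ_{u/v}(n)]_t ∈ [[y]_k − 1/u^k, [y]_k) if and only if n ≡ Σ_{j=1}^{k} σ_j^{-1}(y_j)·u^{j−1}·v̄^j + b·u^{k−1}·v̄^k (mod u^k). -/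
open Finset

/-- Digits `d r < u` at the positions `k ≤ r < t` contribute less than `1 / u ^ k`. -/
lemma sum_digits_mem_Ico {u : ℕ} (hu : 0 < u) {d : ℕ → ℕ} (hd : ∀ r, d r < u) {k t : ℕ}
    (hkt : k ≤ t) :
    ∑ r ∈ range t, (d r : ℝ) / (u : ℝ) ^ (r + 1) ∈
      Set.Ico (∑ r ∈ range k, (d r : ℝ) / (u : ℝ) ^ (r + 1))
        ((∑ r ∈ range k, (d r : ℝ) / (u : ℝ) ^ (r + 1)) + 1 / (u : ℝ) ^ k) := by
  have hu' : (0 : ℝ) < u := by exact_mod_cast hu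
  suffices h : ∑ r ∈ range k, (d r : ℝ) / (u : ℝ) ^ (r + 1) ≤
        ∑ r ∈ range t, (d r : ℝ) / (u : ℝ) ^ (r + 1) ∧
      ∑ r ∈ range t, (d r : ℝ) / (u : ℝ) ^ (r + 1) ≤
        (∑ r ∈ range k, (d r : ℝ) / (u : ℝ) ^ (r + 1)) + 1 / (u : ℝ) ^ k - 1 / (u : ℝ) ^ t by
    have : 0 < 1 / (u : ℝ) ^ t := by positivity
    exact ⟨h.1, by linarith [h.2]⟩
  induction t, hkt using Nat.le_induction with
  | base => simp
  | succ t _ ih =>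
    rw [sum_range_succ]
    have h0 : 0 ≤ (d t : ℝ) / (u : ℝ) ^ (t + 1) := by positivity
    have h1 : (d t : ℝ) / (u : ℝ) ^ (t + 1) ≤ 1 / (u : ℝ) ^ t - 1 / (u : ℝ) ^ (t + 1) := by
      have hdt : (d t : ℝ) + 1 ≤ u := by exact_mod_cast hd t
      have he : 1 / (u : ℝ) ^ t = u / (u : ℝ) ^ (t + 1) := by
        field_simp
        ring
      rw [he, ← sub_div]
      gcongr
      linarith
    exact ⟨by linarith [ih.1], by linarith [ih.2]⟩

/-- A finite `u`-adic expansion lies in the elementary interval of order `k` with digits `w`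
exactly when its first `k` digits are those of `w`. -/
lemma sum_digits_mem_Ico_iff {u : ℕ} (hu : 0 < u) {d w : ℕ → ℕ} (hd : ∀ r, d r < u)
    (hw : ∀ r, w r < u) {k t : ℕ} (hkt : k ≤ t) :
    ∑ r ∈ range t, (d r : ℝ) / (u : ℝ) ^ (r + 1) ∈
      Set.Ico (∑ r ∈ range k, (w r : ℝ) / (u : ℝ) ^ (r + 1))
        ((∑ r ∈ range k, (w r : ℝ) / (u : ℝ) ^ (r + 1)) + 1 / (u : ℝ) ^ k) ↔
      ∀ r < k, d r = w r := by
  have hu' : (0 : ℝ) < u := by exact_mod_cast hu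
  have hcongr : ∀ m, (∀ r < m, d r = w r) →
      ∑ r ∈ range m, (d r : ℝ) / (u : ℝ) ^ (r + 1) =
        ∑ r ∈ range m, (w r : ℝ) / (u : ℝ) ^ (r + 1) := fun m h =>
    sum_congr rfl fun r hr => by rw [h r (mem_range.1 hr)]
  refine ⟨fun h => ?_, fun h => hcongr k h ▸ sum_digits_mem_Ico hu hd hkt⟩
  induction k with
  | zero => simp
  | succ k ih =>
    have hnest : (w k : ℝ) / (u : ℝ) ^ (k + 1) + 1 / (u : ℝ) ^ (k + 1) ≤ 1 / (u : ℝ) ^ k := by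
      have hwk : (w k : ℝ) + 1 ≤ u := by exact_mod_cast hw k
      have he : 1 / (u : ℝ) ^ k = u / (u : ℝ) ^ (k + 1) := by
        field_simp
        ring
      rw [he, ← add_div]
      gcongr
    have h0 : 0 ≤ (w k : ℝ) / (u : ℝ) ^ (k + 1) := by positivity
    have hd' := sum_digits_mem_Ico hu hd hkt
    simp only [sum_range_succ _ k, Set.mem_Ico] at h hd'
    have hlow := ih (by omega) ⟨by linarith [h.1], by linarith [h.2]⟩
    rw [hcongr k hlow] at hd'
    have h1 : (d k : ℝ) < w k + 1 := by
      have : (d k : ℝ) / (u : ℝ) ^ (k + 1) < (w k + 1) / (u : ℝ) ^ (k + 1) := by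
        rw [add_div]; linarith [hd'.1, h.2]
      exact (div_lt_div_iff_of_pos_right (by positivity)).1 this
    have h2 : (w k : ℝ) < d k + 1 := by
      have : (w k : ℝ) / (u : ℝ) ^ (k + 1) < (d k + 1) / (u : ℝ) ^ (k + 1) := by
        rw [add_div]; linarith [hd'.2, h.1]
      exact (div_lt_div_iff_of_pos_right (by positivity)).1 this
    norm_cast at h1 h2
    intro r hr
    rcases Nat.lt_succ_iff_lt_or_eq.1 hr with hr | rfl
    · exact hlow r hr
    · omega

lemma mul_ratZ_succ_add_ratDigit {u : ℕ} (hu : 0 < u) (v : ℕ) (z : ℤ) (r : ℕ) :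
    (u : ℤ) * ratZ u v z (r + 1) + ratDigit u v z r = v * ratZ u v z r := by
  have h0 := Int.emod_nonneg ((v : ℤ) * ratZ u v z r) (by omega : (u : ℤ) ≠ 0)
  rw [ratZ, ratDigit, Int.toNat_of_nonneg h0,
    Int.mul_ediv_cancel' (Int.dvd_self_sub_emod)]
  ring

/-- Partial formal expansion of `z`, with remainder, modulo any `M` for which `vbar` is an
inverse of `v`. -/
lemma modEq_sum_ratDigit_add {u : ℕ} (hu : 0 < u) {v vbar : ℕ} {M : ℤ}
    (hvbar : (v : ℤ) * vbar ≡ 1 [ZMOD M]) (z : ℤ) (m : ℕ) :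
    z ≡ (∑ j ∈ range m, (ratDigit u v z j : ℤ) * u ^ j * vbar ^ (j + 1)) +
      u ^ m * vbar ^ m * ratZ u v z m [ZMOD M] := by
  induction m with
  | zero => simp [ratZ, Int.ModEq.refl]
  | succ m ih =>
    refine ih.trans ?_
    have h := hvbar.symm.mul_left ((u : ℤ) ^ m * vbar ^ m * ratZ u v z m)
    rw [sum_range_succ, add_assoc]
    refine Int.ModEq.add_left _ ?_
    rw [mul_one] at h
    convert h using 1
    linear_combination ((u : ℤ) ^ m * vbar ^ (m + 1)) * mul_ratZ_succ_add_ratDigit hu v z m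

/-- Digits below `u` are determined by `∑ c_j u^j vbar^(j+1)` modulo `u ^ k` when `vbar` is
coprime to `u`. -/
lemma eq_of_sum_modEq {u vbar : ℕ} (hu : 0 < u) (hcop : IsCoprime (u : ℤ) vbar) {a c : ℕ → ℕ}
    (ha : ∀ r, a r < u) (hc : ∀ r, c r < u) {k : ℕ}
    (h : ∑ j ∈ range k, (a j : ℤ) * u ^ j * vbar ^ (j + 1) ≡
      ∑ j ∈ range k, (c j : ℤ) * u ^ j * vbar ^ (j + 1) [ZMOD (u : ℤ) ^ k]) :
    ∀ r < k, a r = c r := by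
  induction k with
  | zero => simp
  | succ k ih =>
    have hvanish : ∀ e : ℕ → ℕ, ∑ j ∈ range (k + 1), (e j : ℤ) * u ^ j * vbar ^ (j + 1) ≡
        ∑ j ∈ range k, (e j : ℤ) * u ^ j * vbar ^ (j + 1) [ZMOD (u : ℤ) ^ k] := fun e => by
      refine (Int.modEq_iff_dvd.2 ⟨e k * vbar ^ (k + 1), ?_⟩).symm
      rw [sum_range_succ]
      ring
    have hlow := ih (((hvanish a).symm.trans (h.of_dvd (pow_dvd_pow _ k.le_succ))).trans
      (hvanish c))
    have hdvd := Int.modEq_iff_dvd.1 h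
    rw [sum_range_succ, sum_range_succ,
      sum_congr rfl fun r hr => by rw [← hlow r (mem_range.1 hr)], add_sub_add_left_eq_sub,
      show (c k : ℤ) * u ^ k * vbar ^ (k + 1) - a k * u ^ k * vbar ^ (k + 1) =
        u ^ k * (((c k : ℤ) - a k) * vbar ^ (k + 1)) by ring, pow_succ] at hdvd
    have hk := hcop.pow_right.dvd_of_dvd_mul_right
      (Int.dvd_of_mul_dvd_mul_left (by positivity) hdvd)
    have hmod : a k ≡ c k [MOD u] := Nat.modEq_iff_dvd.2 hk
    intro r hr
    rcases Nat.lt_succ_iff_lt_or_eq.1 hr with hr | rfl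
    · exact hlow r hr
    · exact hmod.eq_of_lt_of_lt (ha r) (hc r)

/-- The first `k` formal `u/v`-adic digits of `z` are `c` exactly when `z` lies in the
corresponding residue class modulo `u ^ k`. -/
lemma ratDigit_eq_iff_modEq_s6 {u v vbar k : ℕ} (hu : 0 < u)
    (hvbar : (v : ℤ) * vbar ≡ 1 [ZMOD (u : ℤ) ^ k]) (z : ℤ) {c : ℕ → ℕ} (hc : ∀ r, c r < u) :
    (∀ r < k, ratDigit u v z r = c r) ↔
      z ≡ ∑ j ∈ range k, (c j : ℤ) * u ^ j * vbar ^ (j + 1) [ZMOD (u : ℤ) ^ k] := by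
  have hz : z ≡ ∑ j ∈ range k, (ratDigit u v z j : ℤ) * u ^ j * vbar ^ (j + 1)
      [ZMOD (u : ℤ) ^ k] := by
    refine (modEq_sum_ratDigit_add hu hvbar z k).trans
      (Int.modEq_iff_dvd.2 ⟨vbar ^ k * ratZ u v z k, ?_⟩).symm
    ring
  refine ⟨fun h => ?_, fun h => ?_⟩
  · rwa [sum_congr rfl fun r hr => by rw [h r (mem_range.1 hr)]] at hz
  · rcases Nat.eq_zero_or_pos k with rfl | hk
    · simp
    have hcop : IsCoprime (u : ℤ) vbar := by
      obtain ⟨q, hq⟩ :=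
        (dvd_pow_self (u : ℤ) hk.ne').trans (Int.modEq_iff_dvd.1 hvbar)
      exact ⟨q, v, by linear_combination -hq⟩
    exact eq_of_sum_modEq hu hcop (ratDigit_lt hu v z) hc (hz.symm.trans h)

/-- **Lemma 2, item 3.** With `b ∈ {1,…,u−1}` satisfying
`b ≡ σ_k^{-1}(y_k − 1) − σ_k^{-1}(y_k) (mod u)`:
`[φ^Σ_{u/v}(n)]_t ∈ [[y]_k − 1/u^k, [y]_k)` iff
`n ≡ Σ_{j=1}^{k} σ_j^{-1}(y_j)·u^{j−1}·v̄^j + b·u^{k−1}·v̄^k (mod u^k)`. -/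
theorem ratPhiTrunc_mem_Ico_left_iff_modEq
    (u v : ℕ) (hu : 2 ≤ u) (hv : 1 ≤ v) (huv : Nat.Coprime u v)
    (σ σinv : ℕ → ℕ → ℕ)
    (hσ : ∀ r, Set.BijOn (σ r) (Set.Iio u) (Set.Iio u))
    (hinv : ∀ r, Set.InvOn (σinv r) (σ r) (Set.Iio u) (Set.Iio u))
    (hinvmap : ∀ r, Set.MapsTo (σinv r) (Set.Iio u) (Set.Iio u))
    (k t : ℕ) (hk : 1 ≤ k) (hkt : k ≤ t)
    (y : ℕ → ℕ) (hy : ∀ j, y j < u) (hyk : 0 < y (k - 1))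
    (vbar : ℕ) (hvbar : v * vbar ≡ 1 [MOD u ^ k])
    (b : ℕ) (hb1 : 1 ≤ b) (hb2 : b < u)
    (hbcong : (b : ℤ) ≡ (σinv (k - 1) (y (k - 1) - 1) : ℤ) - (σinv (k - 1) (y (k - 1)) : ℤ)
      [ZMOD (u : ℤ)])
    (n : ℕ) :
    ratPhiTrunc u v σ t n ∈
      Set.Ico ((∑ j ∈ Finset.range k, (y j : ℝ) / (u : ℝ) ^ (j + 1)) - 1 / (u : ℝ) ^ k)
        (∑ j ∈ Finset.range k, (y j : ℝ) / (u : ℝ) ^ (j + 1)) ↔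
      n ≡ (∑ j ∈ Finset.range k, σinv j (y j) * u ^ j * vbar ^ (j + 1)) +
          b * u ^ (k - 1) * vbar ^ k [MOD u ^ k] := by
  have hu0 : 0 < u := by omega
  obtain ⟨m, rfl⟩ : ∃ m, k = m + 1 := ⟨k - 1, by omega⟩
  simp only [Nat.add_sub_cancel] at hyk hbcong ⊢
  set w : ℕ → ℕ := Function.update y m (y m - 1) with hw
  have hwm : w m = y m - 1 := by simp [hw]
  have hwne : ∀ j ∈ range m, w j = y j := fun j hj =>
    Function.update_of_ne (mem_range.1 hj).ne _ _
  have hwlt : ∀ j, w j < u := fun j => by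
    rcases eq_or_ne j m with rfl | hj
    · rw [hwm]; have := hy j; omega
    · rw [hw, Function.update_of_ne hj]; exact hy j
  have hdigit : ∀ r, ratDigit u v n r < u := ratDigit_lt hu0 v n
  have hlower : (∑ j ∈ range (m + 1), (y j : ℝ) / (u : ℝ) ^ (j + 1)) - 1 / (u : ℝ) ^ (m + 1) =
      ∑ j ∈ range (m + 1), (w j : ℝ) / (u : ℝ) ^ (j + 1) := by
    rw [sum_range_succ, sum_range_succ, hwm, Nat.cast_pred hyk,
      sum_congr rfl fun j hj => by rw [← hwne j hj]]
    ring
  have hresidue : ((((∑ j ∈ range (m + 1), σinv j (y j) * u ^ j * vbar ^ (j + 1)) +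
        b * u ^ m * vbar ^ (m + 1) : ℕ)) : ℤ) ≡
      ∑ j ∈ range (m + 1), (σinv j (w j) : ℤ) * u ^ j * vbar ^ (j + 1)
        [ZMOD (u : ℤ) ^ (m + 1)] := by
    obtain ⟨q, hq⟩ := Int.modEq_iff_dvd.1 hbcong
    refine Int.modEq_iff_dvd.2 ⟨q * vbar ^ (m + 1), ?_⟩
    push_cast
    rw [sum_range_succ, sum_range_succ, hwm, sum_congr rfl fun j hj => by rw [hwne j hj]]
    linear_combination ((u : ℤ) ^ m * vbar ^ (m + 1)) * hq
  have hvbar' : (v : ℤ) * vbar ≡ 1 [ZMOD (u : ℤ) ^ (m + 1)] := by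
    exact_mod_cast Int.natCast_modEq_iff.2 hvbar
  rw [← sub_add_cancel (∑ j ∈ range (m + 1), (y j : ℝ) / (u : ℝ) ^ (j + 1))
      (1 / (u : ℝ) ^ (m + 1)), add_sub_cancel_right, hlower, ratPhiTrunc,
    sum_digits_mem_Ico_iff hu0 (d := fun r => σ r (ratDigit u v n r))
      (fun r => (hσ r).mapsTo (hdigit r)) hwlt hkt,
    ← Int.natCast_modEq_iff, Nat.cast_pow]
  have hperm : ∀ r, σ r (ratDigit u v n r) = w r ↔ ratDigit u v n r = σinv r (w r) := fun r =>
    ⟨fun h => by rw [← h, (hinv r).1 (hdigit r)], fun h => by rw [h, (hinv r).2 (hwlt r)]⟩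
  simp only [hperm]
  rw [ratDigit_eq_iff_modEq_s6 hu0 hvbar' n fun r => hinvmap r (hwlt r)]
  exact ⟨fun h => h.trans hresidue.symm, fun h => h.trans hresidue⟩
end
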